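/- Fix d > 0 and a distortion measure ρ ∈ D, and let ρ_min = min{ρ(j,k) : ρ(j,k) > 0}. Then for all sufficiently large n and all a ≥ √(2J + 2), sup_{p ∈ P(A)} | E_p[R(T,d,ρ)] − R(p,d,ρ) | ≤ (7ρ_max/ρ_min)·(a·√J·√(ln n / n))·ln( J·K·√n / (a·√(J ln n)) ) + ln(K)·e^{J−1}/n². -/

import Mathlib

open Filter MeasureTheory
open scoped BigOperators

noncomputable section

variable {A B : Type*}

/-- `p` is a probability distribution on the finite alphabet `A`. -/
def IsProb [Fintype A] (p : A → ℝ) : Prop :=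
  (∀ a, 0 ≤ p a) ∧ ∑ a, p a = 1

/-- `Q` is a conditional probability distribution from `A` to `B`. -/
def IsCondProb [Fintype A] [Fintype B] (Q : A → B → ℝ) : Prop :=
  ∀ j, IsProb (Q j)

/-- `ρ` is a distortion measure in the class `D`: bounded in `[0, ρmax]` and
with `max_j min_k ρ(j,k) = 0` (equivalently, every row contains a zero). -/
def IsDistMeasure [Fintype A] [Fintype B] (ρmax : ℝ) (ρ : A → B → ℝ) : Prop :=
  (∀ j k, 0 ≤ ρ j k ∧ ρ j k ≤ ρmax) ∧ ∀ j, ∃ k, ρ j k = 0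

/-- Mutual information `I(p, Q)` in nats. -/
def mutualInfo [Fintype A] [Fintype B] (p : A → ℝ) (Q : A → B → ℝ) : ℝ :=
  ∑ j, ∑ k, p j * Q j k * Real.log (Q j k / ∑ j', p j' * Q j' k)

/-- Average distortion `Σ_{j,k} p(j) Q(k|j) ρ(j,k)`. -/
def avgDist [Fintype A] [Fintype B] (p : A → ℝ) (Q : A → B → ℝ) (ρ : A → B → ℝ) : ℝ :=
  ∑ j, ∑ k, p j * Q j k * ρ j k

/-- The rate-distortion function `R(p,d,ρ)` in nats. -/
def RD [Fintype A] [Fintype B] (p : A → ℝ) (d : ℝ) (ρ : A → B → ℝ) : ℝ :=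
  sInf { r | ∃ Q, IsCondProb Q ∧ avgDist p Q ρ ≤ d ∧ r = mutualInfo p Q }

/-- The type (empirical distribution) of a sequence `x ∈ A^n`. -/
def typeOf [DecidableEq A] {n : ℕ} (x : Fin n → A) : A → ℝ :=
  fun a => ((Finset.univ.filter fun i => x i = a).card : ℝ) / n

/-- The i.i.d. product probability `p^n(x) = ∏ i p(x_i)`. -/
def prodProb {n : ℕ} (p : A → ℝ) (x : Fin n → A) : ℝ :=
  ∏ i, p (x i)

/-- The `n`-fold single-letter distortion `ρ_n(x,y) = (1/n) Σ_i ρ(x_i, y_i)`. -/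
def nDist {n : ℕ} (ρ : A → B → ℝ) (x : Fin n → A) (y : Fin n → B) : ℝ :=
  (∑ i, ρ (x i) (y i)) / n

/-- `E_p[R(T,d,ρ)]`, the expectation of the empirical rate-distortion function
over `X^n` i.i.d. `p` (written as a sum over sequences). -/
def expTypeRD [Fintype A] [DecidableEq A] [Fintype B] (n : ℕ) (p : A → ℝ)
    (d : ℝ) (ρ : A → B → ℝ) : ℝ :=
  ∑ x : Fin n → A, prodProb p x * RD (typeOf x) d ρ

lemma aux_tangent {h c : ℝ} (hh : 0 ≤ h) (hc : 0 < c) :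
    Real.negMulLog h ≤ -h * Real.log c + c - h := by
  rcases hh.eq_or_lt with rfl | hp
  · simp [hc.le]
  · have h1 := Real.log_le_sub_one_of_pos (div_pos hc hp)
    rw [Real.log_div hc.ne' hp.ne'] at h1
    have h2 := mul_le_mul_of_nonneg_left h1 hh
    have h3 : h * (c / h - 1) = c - h := by field_simp
    unfold Real.negMulLog
    linarith

lemma aux_eta1 {y h c : ℝ} (hy : 0 ≤ y) (hh : 0 ≤ h) (h1 : y + h ≤ 1) (hc : 0 < c) :
    |Real.negMulLog (y + h) - Real.negMulLog y| ≤ h * (-Real.log c) + c := by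
  have ht := aux_tangent hh hc
  have hη := Real.negMulLog_nonneg hh (by linarith)
  have hu : Real.negMulLog (y + h) - Real.negMulLog y ≤ Real.negMulLog h := by
    rcases hh.eq_or_lt with rfl | hp
    · simp
    rcases hy.eq_or_lt with rfl | hyp
    · simp
    have a1 : Real.log y ≤ Real.log (y + h) := Real.log_le_log hyp (by linarith)
    have a2 : Real.log h ≤ Real.log (y + h) := Real.log_le_log hp (by linarith)
    unfold Real.negMulLog
    nlinarith [mul_le_mul_of_nonneg_left a1 hy, mul_le_mul_of_nonneg_left a2 hh]
  have hl : Real.negMulLog y - Real.negMulLog (y + h) ≤ h := by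
    rcases hh.eq_or_lt with rfl | hp
    · simp
    have t := aux_tangent hy (show 0 < y + h by linarith)
    have l0 : Real.log (y + h) ≤ 0 := Real.log_nonpos (by linarith) h1
    have : Real.negMulLog (y + h) = - (y * Real.log (y + h)) - h * Real.log (y + h) := by
      unfold Real.negMulLog; ring
    nlinarith
  rw [abs_le]
  constructor <;> nlinarith

lemma aux_eta {x y c : ℝ} (hx : 0 ≤ x) (hx1 : x ≤ 1) (hy : 0 ≤ y) (hy1 : y ≤ 1) (hc : 0 < c) :
    |Real.negMulLog x - Real.negMulLog y| ≤ |x - y| * (-Real.log c) + c := by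
  rcases le_total y x with h | h
  · have := aux_eta1 (h := x - y) hy (by linarith) (by linarith) hc
    rw [abs_of_nonneg (show 0 ≤ x - y by linarith)]
    simpa using this
  · have := aux_eta1 (h := y - x) hx (by linarith) (by linarith) hc
    rw [abs_sub_comm, abs_sub_comm x y, abs_of_nonneg (show 0 ≤ y - x by linarith)]
    simpa using this

lemma IsProb.le_one' {A : Type*} [Fintype A] {p : A → ℝ} (hp : IsProb p) (a : A) : p a ≤ 1 := by
  rw [← hp.2]
  exact Finset.single_le_sum (fun i _ => hp.1 i) (Finset.mem_univ a)

lemma aux_out {A B : Type*} [Fintype A] [Fintype B] {p : A → ℝ} {Q : A → B → ℝ}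
    (hp : IsProb p) (hQ : IsCondProb Q) : IsProb (fun k => ∑ j, p j * Q j k) := by
  refine ⟨fun k => Finset.sum_nonneg fun j _ => mul_nonneg (hp.1 j) ((hQ j).1 k), ?_⟩
  rw [Finset.sum_comm]
  simp_rw [← Finset.mul_sum, (hQ _).2, mul_one, hp.2]

lemma aux_entropy_le {B : Type*} [Fintype B] [Nonempty B] {r : B → ℝ} (hr : IsProb r) :
    ∑ k, Real.negMulLog (r k) ≤ Real.log (Fintype.card B) := by
  have hK : (0 : ℝ) < Fintype.card B := by exact_mod_cast Fintype.card_pos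
  calc ∑ k, Real.negMulLog (r k)
      ≤ ∑ k, (r k * Real.log (Fintype.card B) + (1 / (Fintype.card B : ℝ)) - r k) := by
        refine Finset.sum_le_sum fun k _ => ?_
        have := aux_tangent (hr.1 k) (show 0 < 1 / (Fintype.card B : ℝ) by positivity)
        rw [one_div, Real.log_inv] at this
        rw [one_div]
        linarith
    _ = Real.log (Fintype.card B) := by
        rw [Finset.sum_sub_distrib, Finset.sum_add_distrib, ← Finset.sum_mul, hr.2]
        simp

lemma aux_entropy_nonneg {B : Type*} [Fintype B] {r : B → ℝ} (hr : IsProb r) :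
    0 ≤ ∑ k, Real.negMulLog (r k) :=
  Finset.sum_nonneg fun k _ => Real.negMulLog_nonneg (hr.1 k) (hr.le_one' k)

lemma aux_pos {A B : Type*} [Fintype A] [Fintype B] {p : A → ℝ} {Q : A → B → ℝ}
    (hp : IsProb p) (hQ : IsCondProb Q) {j : A} {k : B} (h : p j * Q j k ≠ 0) :
    0 < p j ∧ 0 < Q j k ∧ 0 < ∑ j', p j' * Q j' k := by
  have h1 : 0 < p j := (hp.1 j).lt_of_ne' (left_ne_zero_of_mul h)
  have h2 : 0 < Q j k := ((hQ j).1 k).lt_of_ne' (right_ne_zero_of_mul h)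
  refine ⟨h1, h2, lt_of_lt_of_le (mul_pos h1 h2) ?_⟩
  exact Finset.single_le_sum (f := fun j' => p j' * Q j' k)
    (fun j' _ => mul_nonneg (hp.1 j') ((hQ j').1 k)) (Finset.mem_univ j)

lemma aux_mi {A B : Type*} [Fintype A] [Fintype B] {p : A → ℝ} {Q : A → B → ℝ}
    (hp : IsProb p) (hQ : IsCondProb Q) :
    mutualInfo p Q = ∑ k, Real.negMulLog (∑ j, p j * Q j k)
      - ∑ j, p j * ∑ k, Real.negMulLog (Q j k) := by
  have e : ∀ j k, p j * Q j k * Real.log (Q j k / ∑ j', p j' * Q j' k)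
      = -(p j * Q j k) * Real.log (∑ j', p j' * Q j' k) - p j * Real.negMulLog (Q j k) := by
    intro j k
    by_cases h : p j * Q j k = 0
    · unfold Real.negMulLog
      have : p j * (-Q j k * Real.log (Q j k)) = -(p j * Q j k) * Real.log (Q j k) := by ring
      rw [this, h]; simp
    · obtain ⟨h1, h2, h3⟩ := aux_pos hp hQ h
      rw [Real.log_div h2.ne' h3.ne']
      unfold Real.negMulLog
      ring
  unfold mutualInfo
  simp_rw [e, Finset.sum_sub_distrib, Finset.mul_sum]
  congr 1
  rw [Finset.sum_comm]
  refine Finset.sum_congr rfl fun k _ => ?_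
  rw [← Finset.sum_mul, Finset.sum_neg_distrib]
  rfl

lemma aux_mi_le {A B : Type*} [Fintype A] [Fintype B] [Nonempty B] {p : A → ℝ} {Q : A → B → ℝ}
    (hp : IsProb p) (hQ : IsCondProb Q) : mutualInfo p Q ≤ Real.log (Fintype.card B) := by
  rw [aux_mi hp hQ]
  have h1 := aux_entropy_le (aux_out hp hQ)
  have h2 : 0 ≤ ∑ j, p j * ∑ k, Real.negMulLog (Q j k) :=
    Finset.sum_nonneg fun j _ => mul_nonneg (hp.1 j) (aux_entropy_nonneg (hQ j))
  linarith

lemma aux_mi_nonneg {A B : Type*} [Fintype A] [Fintype B] {p : A → ℝ} {Q : A → B → ℝ}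
    (hp : IsProb p) (hQ : IsCondProb Q) : 0 ≤ mutualInfo p Q := by
  have hr := aux_out hp hQ
  have e : ∀ j k, p j * Q j k - p j * (∑ j', p j' * Q j' k)
      ≤ p j * Q j k * Real.log (Q j k / ∑ j', p j' * Q j' k) := by
    intro j k
    by_cases h : p j * Q j k = 0
    · rw [h]
      have := mul_nonneg (hp.1 j) (hr.1 k)
      simp only [zero_mul, zero_sub] at *
      linarith
    · obtain ⟨h1, h2, h3⟩ := aux_pos hp hQ h
      have := Real.one_sub_inv_le_log_of_pos (div_pos h2 h3)
      have := mul_le_mul_of_nonneg_left this (mul_pos h1 h2).le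
      refine le_trans (le_of_eq ?_) this
      field_simp
  unfold mutualInfo
  refine le_trans (le_of_eq ?_) (Finset.sum_le_sum fun j _ => Finset.sum_le_sum fun k _ => e j k)
  simp_rw [Finset.sum_sub_distrib, ← Finset.mul_sum, (hQ _).2, hr.2]
  simp

lemma aux_mi_cont {A B : Type*} [Fintype A] [Fintype B] [Nonempty B] {p q : A → ℝ}
    {Q : A → B → ℝ} (hp : IsProb p) (hq : IsProb q) (hQ : IsCondProb Q) {c : ℝ} (hc : 0 < c)
    (hc1 : c ≤ 1) :
    mutualInfo p Q ≤ mutualInfo q Q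
      + (∑ j, |p j - q j|) * (Real.log (Fintype.card B / c) + Real.log (Fintype.card B)) + c := by
  have hK : (0 : ℝ) < Fintype.card B := by exact_mod_cast Fintype.card_pos
  have hK1 : (1 : ℝ) ≤ Fintype.card B := by exact_mod_cast Fintype.card_pos
  have hL : 0 ≤ Real.log (Fintype.card B / c) :=
    Real.log_nonneg (by rw [le_div_iff₀ hc]; linarith)
  rw [aux_mi hp hQ, aux_mi hq hQ]
  have hrp := aux_out hp hQ
  have hrq := aux_out hq hQ
  have hs : ∑ k, |∑ j, p j * Q j k - ∑ j, q j * Q j k| ≤ ∑ j, |p j - q j| := by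
    calc _ ≤ ∑ k, ∑ j, |p j - q j| * Q j k := by
          refine Finset.sum_le_sum fun k _ => ?_
          rw [← Finset.sum_sub_distrib]
          refine (Finset.abs_sum_le_sum_abs _ _).trans (le_of_eq ?_)
          refine Finset.sum_congr rfl fun j _ => ?_
          rw [← sub_mul, abs_mul, abs_of_nonneg ((hQ j).1 k)]
      _ = _ := by
          rw [Finset.sum_comm]
          simp_rw [← Finset.mul_sum, (hQ _).2, mul_one]
  have h1 : ∑ k, Real.negMulLog (∑ j, p j * Q j k) - ∑ k, Real.negMulLog (∑ j, q j * Q j k)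
      ≤ (∑ j, |p j - q j|) * Real.log (Fintype.card B / c) + c := by
    rw [← Finset.sum_sub_distrib]
    calc _ ≤ ∑ k, (|∑ j, p j * Q j k - ∑ j, q j * Q j k| * Real.log (Fintype.card B / c)
              + c / Fintype.card B) := by
          refine Finset.sum_le_sum fun k _ => ?_
          have := aux_eta (hrp.1 k) (hrp.le_one' k) (hrq.1 k) (hrq.le_one' k) (div_pos hc hK)
          rw [← Real.log_inv, inv_div] at this
          exact (le_abs_self _).trans this
      _ = (∑ k, |∑ j, p j * Q j k - ∑ j, q j * Q j k|) * Real.log (Fintype.card B / c) + c := by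
          rw [Finset.sum_add_distrib, ← Finset.sum_mul]
          simp
          field_simp
      _ ≤ _ := by gcongr
  have h2 : ∑ j, q j * ∑ k, Real.negMulLog (Q j k) - ∑ j, p j * ∑ k, Real.negMulLog (Q j k)
      ≤ (∑ j, |p j - q j|) * Real.log (Fintype.card B) := by
    rw [← Finset.sum_sub_distrib, Finset.sum_mul]
    refine Finset.sum_le_sum fun j _ => ?_
    rw [← sub_mul]
    have a1 := aux_entropy_nonneg (hQ j)
    have a2 := aux_entropy_le (hQ j)
    have a3 : q j - p j ≤ |p j - q j| := by rw [abs_sub_comm]; exact le_abs_self _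
    calc _ ≤ |p j - q j| * ∑ k, Real.negMulLog (Q j k) := by gcongr
      _ ≤ _ := by gcongr
  linarith

/-- Two-term log-sum inequality. -/
lemma aux_logsum {x y u v s t : ℝ} (hx : 0 ≤ x) (hy : 0 ≤ y) (hu : 0 ≤ u) (hv : 0 ≤ v)
    (hxu : x ≠ 0 → 0 < u) (hyv : y ≠ 0 → 0 < v) (hs : 0 < s) (ht : 0 < t) :
    (s * x + t * y) * Real.log ((s * x + t * y) / (s * u + t * v))
      ≤ s * (x * Real.log (x / u)) + t * (y * Real.log (y / v)) := by
  have hX : 0 ≤ s * x + t * y := by positivity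
  rcases hX.eq_or_lt with h0 | hXp
  · have h1 : x = 0 := by
      by_contra h
      have : 0 < x := hx.lt_of_ne' h
      have : 0 < s * x + t * y := by positivity
      linarith
    have h2 : y = 0 := by
      by_contra h
      have : 0 < y := hy.lt_of_ne' h
      have : 0 < s * x + t * y := by positivity
      linarith
    simp [h1, h2]
  have hY : 0 < s * u + t * v := by
    by_cases h : x = 0
    · have : y ≠ 0 := by rintro rfl; simp [h] at hXp
      have := hyv this
      positivity
    · have := hxu h
      positivity
  set X := s * x + t * y with hXd
  set Y := s * u + t * v with hYd
  have key : ∀ x u : ℝ, 0 ≤ x → 0 ≤ u → (x ≠ 0 → 0 < u) →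
      x * Real.log (X / Y) + (x - X / Y * u) ≤ x * Real.log (x / u) := by
    intro x u hx hu hxu
    by_cases h : x = 0
    · subst h
      have : 0 ≤ X / Y * u := by positivity
      simp; exact this
    · have hu' := hxu h
      have hx' : 0 < x := hx.lt_of_ne' h
      have a := Real.one_sub_inv_le_log_of_pos (div_pos (div_pos hx' hu') (div_pos hXp hY))
      rw [Real.log_div (div_pos hx' hu').ne' (div_pos hXp hY).ne'] at a
      have b := mul_le_mul_of_nonneg_left a hx
      have e : x * (1 - (x / u / (X / Y))⁻¹) = x - X / Y * u := by field_simp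
      rw [e] at b
      linarith
  have k1 := mul_le_mul_of_nonneg_left (key x u hx hu hxu) hs.le
  have k2 := mul_le_mul_of_nonneg_left (key y v hy hv hyv) ht.le
  have e : s * (x - X / Y * u) + t * (y - X / Y * v) = 0 := by
    have : s * (x - X / Y * u) + t * (y - X / Y * v) = X - X / Y * Y := by
      rw [hXd, hYd]; ring
    rw [this]; field_simp; ring
  have e2 : X * Real.log (X / Y) = s * (x * Real.log (X / Y)) + t * (y * Real.log (X / Y)) := by
    rw [hXd]; ring
  linarith

lemma aux_mi_convex {A B : Type*} [Fintype A] [Fintype B] {p : A → ℝ} {Q Q' : A → B → ℝ}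
    (hp : IsProb p) (hQ : IsCondProb Q) (hQ' : IsCondProb Q') {s t : ℝ} (hs : 0 < s) (ht : 0 < t) :
    mutualInfo p (fun j k => s * Q j k + t * Q' j k)
      ≤ s * mutualInfo p Q + t * mutualInfo p Q' := by
  unfold mutualInfo
  simp_rw [Finset.mul_sum]
  rw [← Finset.sum_add_distrib]
  refine Finset.sum_le_sum fun j _ => ?_
  rw [← Finset.sum_add_distrib]
  refine Finset.sum_le_sum fun k _ => ?_
  have e : ∑ j', p j' * (s * Q j' k + t * Q' j' k)
      = s * (∑ j', p j' * Q j' k) + t * (∑ j', p j' * Q' j' k) := by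
    rw [Finset.mul_sum, Finset.mul_sum, ← Finset.sum_add_distrib]
    exact Finset.sum_congr rfl fun _ _ => by ring
  rw [e]
  by_cases h : p j = 0
  · simp [h]
  have hl := aux_logsum ((hQ j).1 k) ((hQ' j).1 k) ((aux_out hp hQ).1 k) ((aux_out hp hQ').1 k)
    (fun hx => (aux_pos hp hQ (mul_ne_zero h hx)).2.2)
    (fun hx => (aux_pos hp hQ' (mul_ne_zero h hx)).2.2) hs ht
  have := mul_le_mul_of_nonneg_left hl (hp.1 j)
  linarith

lemma aux_Q0 {A B : Type*} [Fintype A] [Fintype B] {ρmax : ℝ} {ρ : A → B → ℝ}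
    (hρ : IsDistMeasure ρmax ρ) :
    ∃ Q : A → B → ℝ, IsCondProb Q ∧ ∀ p, avgDist p Q ρ = 0 := by
  classical
  choose f hf using hρ.2
  refine ⟨fun j k => if k = f j then 1 else 0, fun j => ⟨fun k => ?_, ?_⟩, fun p => ?_⟩
  · dsimp only; split_ifs <;> norm_num
  · simp
  · unfold avgDist
    simp [hf]

lemma aux_RD_cont {A B : Type*} [Fintype A] [Fintype B] [Nonempty B] {ρmax : ℝ}
    (hρmax : 0 < ρmax) {ρ : A → B → ℝ}
    (hρ : IsDistMeasure ρmax ρ) {d : ℝ} (hd : 0 < d) {p q : A → ℝ} (hp : IsProb p) (hq : IsProb q)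
    {c : ℝ} (hc : 0 < c) (hc1 : c ≤ 1) :
    RD p d ρ ≤ RD q d ρ + ((∑ j, |p j - q j|) * (Real.log (Fintype.card B / c)
      + Real.log (Fintype.card B) + ρmax / d * Real.log (Fintype.card B)) + c) := by
  obtain ⟨Q0, hQ0, hQ0d⟩ := aux_Q0 hρ
  have hK1 : (1 : ℝ) ≤ Fintype.card B := by exact_mod_cast Fintype.card_pos
  have hlK : 0 ≤ Real.log (Fintype.card B) := Real.log_nonneg hK1
  have hs0 : 0 ≤ ∑ j, |p j - q j| := Finset.sum_nonneg fun _ _ => abs_nonneg _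
  have hbdd : BddBelow { r | ∃ Q, IsCondProb Q ∧ avgDist p Q ρ ≤ d ∧ r = mutualInfo p Q } := by
    refine ⟨0, ?_⟩
    rintro r ⟨Q, hQ, -, rfl⟩
    exact aux_mi_nonneg hp hQ
  rw [← sub_le_iff_le_add]
  conv_rhs => unfold RD
  refine le_csInf ⟨_, Q0, hQ0, by rw [hQ0d]; exact hd.le, rfl⟩ ?_
  rintro r ⟨Q, hQ, hQd, rfl⟩
  rw [sub_le_iff_le_add]
  have hcont := aux_mi_cont hp hq hQ hc hc1
  set S := ∑ j, |p j - q j| with hS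
  have hdist : avgDist p Q ρ ≤ d + ρmax * S := by
    have : avgDist p Q ρ - avgDist q Q ρ ≤ ρmax * S := by
      unfold avgDist
      rw [← Finset.sum_sub_distrib, hS, Finset.mul_sum]
      refine Finset.sum_le_sum fun j _ => ?_
      rw [← Finset.sum_sub_distrib]
      calc ∑ k, (p j * Q j k * ρ j k - q j * Q j k * ρ j k)
          ≤ ∑ k, (|p j - q j| * ρmax) * Q j k := by
            refine Finset.sum_le_sum fun k _ => ?_
            have e : p j * Q j k * ρ j k - q j * Q j k * ρ j k
                = ((p j - q j) * ρ j k) * Q j k := by ring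
            rw [e]
            refine mul_le_mul_of_nonneg_right ?_ ((hQ j).1 k)
            have := hρ.1 j k
            calc (p j - q j) * ρ j k ≤ |p j - q j| * ρ j k :=
                  mul_le_mul_of_nonneg_right (le_abs_self _) this.1
              _ ≤ _ := mul_le_mul_of_nonneg_left this.2 (abs_nonneg _)
        _ = ρmax * |p j - q j| := by rw [← Finset.mul_sum, (hQ j).2]; ring
    linarith
  rcases hs0.eq_or_lt with hz | hSp
  · rw [← hz] at hdist hcont ⊢
    have : RD p d ρ ≤ mutualInfo p Q := csInf_le hbdd ⟨Q, hQ, by linarith, rfl⟩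
    linarith
  have hD : 0 < d + ρmax * S := by positivity
  set s := d / (d + ρmax * S) with hs
  set t := ρmax * S / (d + ρmax * S) with ht
  have hsp : 0 < s := by positivity
  have htp : 0 < t := by positivity
  have hst : s + t = 1 := by rw [hs, ht]; field_simp
  have hQm : IsCondProb (fun j k => s * Q j k + t * Q0 j k) := by
    intro j
    refine ⟨fun k => add_nonneg (mul_nonneg hsp.le ((hQ j).1 k)) (mul_nonneg htp.le ((hQ0 j).1 k)), ?_⟩
    rw [Finset.sum_add_distrib, ← Finset.mul_sum, ← Finset.mul_sum, (hQ j).2, (hQ0 j).2]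
    linarith
  have hdm : avgDist p (fun j k => s * Q j k + t * Q0 j k) ρ ≤ d := by
    have e : avgDist p (fun j k => s * Q j k + t * Q0 j k) ρ
        = s * avgDist p Q ρ + t * avgDist p Q0 ρ := by
      unfold avgDist
      simp_rw [Finset.mul_sum, ← Finset.sum_add_distrib]
      exact Finset.sum_congr rfl fun _ _ => Finset.sum_congr rfl fun _ _ => by ring
    rw [e, hQ0d]
    have := mul_le_mul_of_nonneg_left hdist hsp.le
    have e2 : s * (d + ρmax * S) = d := by rw [hs]; field_simp
    linarith
  have h1 : RD p d ρ ≤ mutualInfo p (fun j k => s * Q j k + t * Q0 j k) :=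
    csInf_le hbdd ⟨_, hQm, hdm, rfl⟩
  have h2 := aux_mi_convex hp hQ hQ0 hsp htp
  have h3 := aux_mi_le hp hQ0
  have h4 := aux_mi_nonneg hp hQ
  have h5 : s * mutualInfo p Q ≤ mutualInfo p Q := by nlinarith
  have h6 : t * mutualInfo p Q0 ≤ ρmax / d * S * Real.log (Fintype.card B) := by
    have : t ≤ ρmax / d * S := by
      rw [ht, div_mul_eq_mul_div]
      gcongr
      nlinarith
    calc _ ≤ t * Real.log (Fintype.card B) := by gcongr
      _ ≤ _ := by gcongr
  linarith

lemma aux_moments {A : Type*} [Fintype A] {p : A → ℝ} (hp : IsProb p) (g : A → ℝ)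
    (hg : ∑ a, p a * g a = 0) (hg2 : ∑ a, p a * g a ^ 2 ≤ 1) (n : ℕ) :
    (∑ x : Fin n → A, prodProb p x = 1) ∧
    (∑ x : Fin n → A, prodProb p x * ∑ i, g (x i) = 0) ∧
    (∑ x : Fin n → A, prodProb p x * (∑ i, g (x i)) ^ 2 ≤ n) := by
  induction n with
  | zero => simp [prodProb]
  | succ n ih =>
    obtain ⟨h0, h1, h2⟩ := ih
    have key : ∀ F : (Fin (n + 1) → A) → ℝ,
        ∑ x, F x = ∑ a, ∑ x : Fin n → A, F (Fin.cons a x) := by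
      intro F
      rw [← (Fin.consEquiv (fun _ => A)).sum_comp, Fintype.sum_prod_type]
      rfl
    simp only [key, prodProb, Fin.prod_univ_succ, Fin.sum_univ_succ, Fin.cons_zero,
      Fin.cons_succ] at *
    refine ⟨?_, ?_, ?_⟩
    · simp_rw [← Finset.mul_sum, h0, mul_one, hp.2]
    · have e : ∀ a, ∑ x : Fin n → A, p a * (∏ i, p (x i)) * (g a + ∑ i, g (x i)) = p a * g a := by
        intro a
        have : ∀ x : Fin n → A, p a * (∏ i, p (x i)) * (g a + ∑ i, g (x i))
            = p a * g a * (∏ i, p (x i)) + p a * ((∏ i, p (x i)) * ∑ i, g (x i)) := by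
          intro x; ring
        simp_rw [this, Finset.sum_add_distrib, ← Finset.mul_sum, h0, h1]
        ring
      simp_rw [e, hg]
    · have e : ∀ a, ∑ x : Fin n → A, p a * (∏ i, p (x i)) * (g a + ∑ i, g (x i)) ^ 2
          = p a * g a ^ 2 + p a * ∑ x : Fin n → A, (∏ i, p (x i)) * (∑ i, g (x i)) ^ 2 := by
        intro a
        have : ∀ x : Fin n → A, p a * (∏ i, p (x i)) * (g a + ∑ i, g (x i)) ^ 2
            = p a * g a ^ 2 * (∏ i, p (x i)) + 2 * p a * g a * ((∏ i, p (x i)) * ∑ i, g (x i))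
              + p a * ((∏ i, p (x i)) * (∑ i, g (x i)) ^ 2) := by
          intro x; ring
        simp_rw [this, Finset.sum_add_distrib, ← Finset.mul_sum, h0, h1]
        ring
      simp_rw [e, Finset.sum_add_distrib, ← Finset.sum_mul, hp.2]
      push_cast
      linarith

lemma aux_type_sub {A : Type*} [DecidableEq A] {n : ℕ} (hn : 0 < n) (p : A → ℝ)
    (x : Fin n → A) (j : A) :
    typeOf x j - p j = (∑ i, ((if x i = j then (1 : ℝ) else 0) - p j)) / n := by
  have : (0 : ℝ) < n := by exact_mod_cast hn
  unfold typeOf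
  rw [Finset.sum_sub_distrib, Finset.sum_boole]
  simp
  field_simp

lemma aux_type_prob {A : Type*} [Fintype A] [DecidableEq A] {n : ℕ} (hn : 0 < n)
    (x : Fin n → A) : IsProb (typeOf x) := by
  have : (0 : ℝ) < n := by exact_mod_cast hn
  refine ⟨fun a => by unfold typeOf; positivity, ?_⟩
  unfold typeOf
  rw [← Finset.sum_div, div_eq_one_iff_eq this.ne']
  have := Finset.card_eq_sum_card_fiberwise (s := (Finset.univ : Finset (Fin n)))
    (t := (Finset.univ : Finset A)) (f := x) (fun _ _ => Finset.mem_coe.2 (Finset.mem_univ _))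
  rw [Finset.card_univ, Fintype.card_fin] at this
  exact_mod_cast this.symm

lemma aux_E {A : Type*} [Fintype A] [DecidableEq A] {p : A → ℝ} (hp : IsProb p) {n : ℕ}
    (hn : 0 < n) :
    ∑ x : Fin n → A, prodProb p x * ∑ j, |typeOf x j - p j| ≤ Fintype.card A / Real.sqrt n := by
  have hn' : (0 : ℝ) < n := by exact_mod_cast hn
  have hsq : 0 < Real.sqrt n := Real.sqrt_pos.2 hn'
  have hsq2 : Real.sqrt n * Real.sqrt n = n := Real.mul_self_sqrt hn'.le
  simp_rw [Finset.mul_sum]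
  rw [Finset.sum_comm]
  have key : ∀ j, ∑ x : Fin n → A, prodProb p x * |typeOf x j - p j| ≤ 1 / Real.sqrt n := by
    intro j
    set g : A → ℝ := fun a => (if a = j then (1 : ℝ) else 0) - p j with hg
    have hpj0 := hp.1 j
    have hpj1 := hp.le_one' j
    obtain ⟨m0, m1, m2⟩ := aux_moments hp g
      (by simp [hg, mul_sub, ← Finset.sum_mul, hp.2])
      (by
        rw [← hp.2]
        refine Finset.sum_le_sum fun a _ => ?_
        have : g a ^ 2 ≤ 1 := by
          simp only [hg]; split_ifs <;> nlinarith
        nlinarith [hp.1 a]) n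
    have hpp : ∀ x : Fin n → A, 0 ≤ prodProb p x := fun x => Finset.prod_nonneg fun i _ => hp.1 _
    calc ∑ x : Fin n → A, prodProb p x * |typeOf x j - p j|
        ≤ ∑ x : Fin n → A, (1 / (2 * n * Real.sqrt n) * (prodProb p x * (∑ i, g (x i)) ^ 2)
            + 1 / (2 * Real.sqrt n) * prodProb p x) := by
          refine Finset.sum_le_sum fun x _ => ?_
          rw [aux_type_sub hn p x j]
          have hh : |(∑ i, g (x i)) / n| ≤ 1 / (2 * n * Real.sqrt n) * (∑ i, g (x i)) ^ 2
              + 1 / (2 * Real.sqrt n) := by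
            set S := ∑ i, g (x i)
            rw [abs_div, abs_of_pos hn', ← sq_abs S]
            have : 1 / (2 * n * Real.sqrt n) * |S| ^ 2 + 1 / (2 * Real.sqrt n) - |S| / n
                = (|S| - Real.sqrt n) ^ 2 / (2 * n * Real.sqrt n) := by
              have gen : ∀ w : ℝ, 0 < w → 1 / (2 * (w * w) * w) * |S| ^ 2 + 1 / (2 * w)
                  - |S| / (w * w) = (|S| - w) ^ 2 / (2 * (w * w) * w) := by
                intro w hw; field_simp; ring
              have := gen _ hsq
              rwa [hsq2] at this
            have h0 : 0 ≤ (|S| - Real.sqrt n) ^ 2 / (2 * n * Real.sqrt n) := by positivity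
            linarith
          have := mul_le_mul_of_nonneg_left hh (hpp x)
          linarith
      _ = 1 / (2 * n * Real.sqrt n) * (∑ x : Fin n → A, prodProb p x * (∑ i, g (x i)) ^ 2)
            + 1 / (2 * Real.sqrt n) := by
          rw [Finset.sum_add_distrib, ← Finset.mul_sum, ← Finset.mul_sum, m0, mul_one]
      _ ≤ 1 / (2 * n * Real.sqrt n) * n + 1 / (2 * Real.sqrt n) := by gcongr
      _ = _ := by field_simp; norm_num
  refine (Finset.sum_le_sum fun j _ => key j).trans (le_of_eq ?_)
  simp [div_eq_mul_inv]

lemma aux_exp_RD {A B : Type*} [Fintype A] [DecidableEq A] [Fintype B] [Nonempty B] {ρmax : ℝ}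
    (hρmax : 0 < ρmax) {ρ : A → B → ℝ}
    (hρ : IsDistMeasure ρmax ρ) {d : ℝ} (hd : 0 < d) {p : A → ℝ} (hp : IsProb p)
    {c : ℝ} (hc : 0 < c) (hc1 : c ≤ 1) {n : ℕ} (hn : 0 < n) :
    |expTypeRD n p d ρ - RD p d ρ| ≤ Fintype.card A / Real.sqrt n * (Real.log (Fintype.card B / c)
      + Real.log (Fintype.card B) + ρmax / d * Real.log (Fintype.card B)) + c := by
  have hK1 : (1 : ℝ) ≤ Fintype.card B := by exact_mod_cast Fintype.card_pos
  have hlK : 0 ≤ Real.log (Fintype.card B) := Real.log_nonneg hK1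
  have hL : 0 ≤ Real.log (Fintype.card B / c) :=
    Real.log_nonneg (by rw [le_div_iff₀ hc]; linarith)
  set M := Real.log (Fintype.card B / c)
      + Real.log (Fintype.card B) + ρmax / d * Real.log (Fintype.card B) with hM
  have hM0 : 0 ≤ M := by positivity
  have m0 := (aux_moments hp (fun _ => 0) (by simp) (by simp) n).1
  have hpp : ∀ x : Fin n → A, 0 ≤ prodProb p x := fun x => Finset.prod_nonneg fun i _ => hp.1 _
  have e : expTypeRD n p d ρ - RD p d ρ
      = ∑ x : Fin n → A, prodProb p x * (RD (typeOf x) d ρ - RD p d ρ) := by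
    unfold expTypeRD
    simp_rw [mul_sub, Finset.sum_sub_distrib, ← Finset.sum_mul, m0, one_mul]
  rw [e]
  calc _ ≤ ∑ x : Fin n → A, |prodProb p x * (RD (typeOf x) d ρ - RD p d ρ)| :=
        Finset.abs_sum_le_sum_abs _ _
    _ ≤ ∑ x : Fin n → A, (prodProb p x * (∑ j, |typeOf x j - p j|) * M + prodProb p x * c) := by
        refine Finset.sum_le_sum fun x _ => ?_
        rw [abs_mul, abs_of_nonneg (hpp x), mul_assoc, ← mul_add]
        refine mul_le_mul_of_nonneg_left ?_ (hpp x)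
        have ht := aux_type_prob hn x
        have h1 := aux_RD_cont hρmax hρ hd ht hp hc hc1
        have h2 := aux_RD_cont hρmax hρ hd hp ht hc hc1
        simp_rw [abs_sub_comm (p _)] at h2
        rw [← hM] at h1 h2
        rw [abs_le]; constructor <;> linarith
    _ = (∑ x : Fin n → A, prodProb p x * (∑ j, |typeOf x j - p j|)) * M + c := by
        rw [Finset.sum_add_distrib, ← Finset.sum_mul, ← Finset.sum_mul, m0, one_mul]
    _ ≤ _ := by
        gcongr
        exact aux_E hp hn

/-- Lemma 8: fix `d > 0` and `ρ ∈ D`, and let `ρmin` be the minimum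
positive value of `ρ`. Then for every `a ≥ √(2J+2)` and all sufficiently large `n`,
`sup_p |E_p[R(T,d,ρ)] − R(p,d,ρ)|
  ≤ (7ρmax/ρmin)(a √J √(ln n/n)) ln(JK√n/(a√(J ln n))) + ln(K) e^{J−1}/n²`. -/
theorem expTypeRD_convergence_rate (J K : ℕ) (hJ : 0 < J) (hK : 0 < K)
    (ρmax : ℝ) (hρmax : 0 < ρmax) (d : ℝ) (hd : 0 < d)
    (ρ : Fin J → Fin K → ℝ) (hρ : IsDistMeasure ρmax ρ)
    (ρmin : ℝ) (hρmin_pos : 0 < ρmin)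
    (hρmin_le : ∀ j k, 0 < ρ j k → ρmin ≤ ρ j k)
    (hρmin_mem : ∃ j k, ρ j k = ρmin)
    (a : ℝ) (ha : Real.sqrt (2 * (J : ℝ) + 2) ≤ a) :
    ∃ N : ℕ, ∀ n : ℕ, N ≤ n →
      ∀ p : Fin J → ℝ, IsProb p →
        |expTypeRD n p d ρ - RD p d ρ|
          ≤ (7 * ρmax / ρmin) * (a * Real.sqrt (J : ℝ) * Real.sqrt (Real.log n / n)) *
              Real.log ((J : ℝ) * K * Real.sqrt n / (a * Real.sqrt ((J : ℝ) * Real.log n)))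
            + Real.log K * (Real.exp ((J : ℝ) - 1) / (n : ℝ) ^ 2) := by
  have hJr : (1 : ℝ) ≤ J := by exact_mod_cast hJ
  have hKr : (1 : ℝ) ≤ K := by exact_mod_cast hK
  have hlK : 0 ≤ Real.log K := Real.log_nonneg hKr
  have : Nonempty (Fin K) := ⟨⟨0, hK⟩⟩
  have hapos : 0 < a := lt_of_lt_of_le (Real.sqrt_pos.2 (by positivity)) ha
  have haJ : Real.sqrt J ≤ a := le_trans (Real.sqrt_le_sqrt (by linarith)) ha
  have hratio : 1 ≤ ρmax / ρmin := by
    obtain ⟨j, k, hjk⟩ := hρmin_mem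
    rw [le_div_iff₀ hρmin_pos, one_mul, ← hjk]
    exact (hρ.1 j k).2
  set C : ℝ := Real.log K + ρmax / d * Real.log K + 1 with hC
  have hlim : Tendsto (fun n : ℕ => a * Real.sqrt (J : ℝ) * Real.sqrt (Real.log n / n))
      atTop (nhds 0) := by
    have h1 : Tendsto (fun n : ℕ => Real.log n / n) atTop (nhds 0) := by
      have := Real.isLittleO_log_id_atTop.tendsto_div_nhds_zero
      exact this.comp tendsto_natCast_atTop_atTop
    have h2 := (h1.sqrt).const_mul (a * Real.sqrt (J : ℝ))
    simpa using h2
  have hev := hlim.eventually (gt_mem_nhds (Real.exp_pos (-C)))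
  have hev1 := hlim.eventually (gt_mem_nhds (zero_lt_one))
  obtain ⟨N, hN⟩ := eventually_atTop.1 ((hev.and hev1).and (eventually_ge_atTop 3))
  refine ⟨N, fun n hn p hp => ?_⟩
  obtain ⟨⟨hδC, hδ1⟩, hn3⟩ := hN n hn
  have hnr : (3 : ℝ) ≤ n := by exact_mod_cast hn3
  have hn0 : (0 : ℝ) < n := by linarith
  have hlog : 1 ≤ Real.log n := by
    rw [Real.le_log_iff_exp_le hn0]
    linarith [Real.exp_one_lt_d9]
  set δ := a * Real.sqrt (J : ℝ) * Real.sqrt (Real.log n / n) with hδ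
  have hδpos : 0 < δ := by positivity
  have hb := aux_exp_RD hρmax hρ hd hp hδpos hδ1.le (show 0 < n by omega)
  simp only [Fintype.card_fin] at hb
  have harg : (J : ℝ) * K * Real.sqrt n / (a * Real.sqrt ((J : ℝ) * Real.log n))
      = J * (K / δ) := by
    rw [hδ, Real.sqrt_div (by linarith), Real.sqrt_mul (by linarith)]
    field_simp
  have hEs : (J : ℝ) / Real.sqrt n ≤ δ := by
    rw [hδ, Real.sqrt_div (by linarith), ← mul_div_assoc]
    have h1 : 1 ≤ Real.sqrt (Real.log n) := Real.one_le_sqrt.2 hlog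
    have h2 : (J : ℝ) = Real.sqrt J * Real.sqrt J := (Real.mul_self_sqrt (by linarith)).symm
    have h3 : (J : ℝ) ≤ a * Real.sqrt J := by
      conv_lhs => rw [h2]
      gcongr
    gcongr
    nlinarith
  have hKδ : 0 < (K : ℝ) / δ := by positivity
  rw [harg, Real.log_mul (by positivity) hKδ.ne']
  have hlJ : 0 ≤ Real.log J := Real.log_nonneg hJr
  have hlδ : C ≤ Real.log (K / δ) := by
    rw [Real.log_div (by positivity) hδpos.ne']
    have := (Real.log_lt_log hδpos hδC)
    rw [Real.log_exp] at this
    linarith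
  have hC1 : 1 ≤ C := by
    have : 0 ≤ ρmax / d * Real.log K := by positivity
    linarith
  have htail : 0 ≤ Real.log K * (Real.exp ((J : ℝ) - 1) / (n : ℝ) ^ 2) := by positivity
  set L := Real.log (K / δ) with hL
  have hmain : (J : ℝ) / Real.sqrt n * (L + Real.log K + ρmax / d * Real.log K) + δ
      ≤ δ * (2 * L) := by
    have h0 : 0 ≤ L + Real.log K + ρmax / d * Real.log K := by
      have : 0 ≤ ρmax / d * Real.log K := by positivity
      linarith
    calc _ ≤ δ * (L + Real.log K + ρmax / d * Real.log K) + δ := by gcongr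
      _ = δ * (L + C) := by rw [hC]; ring
      _ ≤ _ := by gcongr; linarith
  have hfin : δ * (2 * L) ≤ (7 * ρmax / ρmin) * δ * (Real.log J + L) := by
    have h7 : 7 ≤ 7 * ρmax / ρmin := by rw [mul_div_assoc]; linarith
    calc δ * (2 * L) ≤ δ * (7 * (Real.log J + L)) :=
          mul_le_mul_of_nonneg_left (by linarith) hδpos.le
      _ = 7 * δ * (Real.log J + L) := by ring
      _ ≤ _ := by
        have : 0 ≤ Real.log J + L := by linarith
        gcongr
  linarith
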